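/- The logic obtained from classical logic by dropping only the law of non-contradiction is paraconsistent: letting ⊢_LPL be the smallest structural and non-trivial logical consequence relation satisfying all the defining conditions of ⊢_BDL together with ¬⊥ ⊢ A₁, ¬A₁ for all formulas A₁, for distinct propositional variables p and q it is not the case that {¬p, p} ⊢_LPL {q}. -/

import Mathlib

/-- Formulas over a countably infinite set of propositional variables,
with connectives ⊥ (falsity), ¬ (negation), and ∧, ∨, → (binary). -/
inductive Form : Type
  | var : ℕ → Form
  | fls : Form
  | neg : Form → Form
  | conj : Form → Form → Form
  | disj : Form → Form → Form
  | impl : Form → Form → Form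

/-- Substitution of formulas for propositional variables. -/
def Form.subst (σ : ℕ → Form) : Form → Form
  | .var p => σ p
  | .fls => .fls
  | .neg A => .neg (A.subst σ)
  | .conj A B => .conj (A.subst σ) (B.subst σ)
  | .disj A B => .disj (A.subst σ) (B.subst σ)
  | .impl A B => .impl (A.subst σ) (B.subst σ)

/-- A (Scott) logical consequence relation: reflexivity, monotonicity, cut. -/
def IsConsRel (C : Set Form → Set Form → Prop) : Prop :=
  (∀ Γ Δ : Set Form, (Γ ∩ Δ).Nonempty → C Γ Δ) ∧
  (∀ Γ Δ Γ' Δ' : Set Form, C Γ Δ → Γ ⊆ Γ' → Δ ⊆ Δ' → C Γ' Δ') ∧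
  (∀ (Γ Δ Γ' Δ' : Set Form) (A : Form),
    C Γ (insert A Δ) → C (insert A Γ') Δ' → C (Γ ∪ Γ') (Δ ∪ Δ'))

/-- Structurality: closure under substitutions. -/
def Structural (C : Set Form → Set Form → Prop) : Prop :=
  ∀ (Γ Δ : Set Form) (σ : ℕ → Form), C Γ Δ → C (Form.subst σ '' Γ) (Form.subst σ '' Δ)

/-- Non-triviality: some non-empty Γ, Δ with ¬ C Γ Δ. -/
def NonTrivial (C : Set Form → Set Form → Prop) : Prop :=
  ∃ Γ Δ : Set Form, Γ.Nonempty ∧ Δ.Nonempty ∧ ¬ C Γ Δ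

/-- Defining conditions of the classical consequence relation ⊢_CL. -/
def CLconds (C : Set Form → Set Form → Prop) : Prop :=
  (∀ Γ Δ : Set Form, C (insert Form.fls Γ) Δ) ∧
  (∀ (Γ Δ : Set Form) (A : Form), C Γ (insert (Form.neg A) Δ) ↔ C (insert A Γ) Δ) ∧
  (∀ (Γ Δ : Set Form) (A B : Form),
    C Γ (insert (Form.conj A B) Δ) ↔ C Γ (insert A Δ) ∧ C Γ (insert B Δ)) ∧
  (∀ (Γ Δ : Set Form) (A B : Form),
    C (insert (Form.disj A B) Γ) Δ ↔ C (insert A Γ) Δ ∧ C (insert B Γ) Δ) ∧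
  (∀ (Γ Δ : Set Form) (A B : Form),
    C Γ (insert (Form.impl A B) Δ) ↔ C (insert A Γ) (insert B Δ))

/-- Defining conditions of the consequence relation ⊢_BDL. -/
def BDLconds (C : Set Form → Set Form → Prop) : Prop :=
  (∀ Γ Δ : Set Form, C (insert Form.fls Γ) Δ) ∧
  (∀ (Γ Δ : Set Form) (A B : Form),
    C Γ (insert (Form.conj A B) Δ) ↔ C Γ (insert A Δ) ∧ C Γ (insert B Δ)) ∧
  (∀ (Γ Δ : Set Form) (A B : Form),
    C (insert (Form.disj A B) Γ) Δ ↔ C (insert A Γ) Δ ∧ C (insert B Γ) Δ) ∧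
  (∀ (Γ Δ : Set Form) (A B : Form),
    C Γ (insert (Form.impl A B) Δ) ↔ C (insert A Γ) (insert B Δ)) ∧
  (∀ Γ Δ : Set Form, C Γ (insert (Form.neg Form.fls) Δ)) ∧
  (∀ (Γ Δ : Set Form) (A : Form),
    C (insert (Form.neg (Form.neg A)) Γ) Δ ↔ C (insert A Γ) Δ) ∧
  (∀ (Γ Δ : Set Form) (A B : Form),
    C (insert (Form.neg (Form.conj A B)) Γ) Δ ↔
      C (insert (Form.neg A) Γ) Δ ∧ C (insert (Form.neg B) Γ) Δ) ∧
  (∀ (Γ Δ : Set Form) (A B : Form),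
    C Γ (insert (Form.neg (Form.disj A B)) Δ) ↔
      C Γ (insert (Form.neg A) Δ) ∧ C Γ (insert (Form.neg B) Δ)) ∧
  (∀ (Γ Δ : Set Form) (A B : Form),
    C (insert (Form.neg (Form.impl A B)) Γ) Δ ↔ C (insert A (insert (Form.neg B) Γ)) Δ)

/-- The law of non-contradiction: ¬A, A ⊢ ⊥. -/
def LNC (C : Set Form → Set Form → Prop) : Prop :=
  ∀ A : Form, C {Form.neg A, A} {Form.fls}

/-- The law of excluded middle: ¬⊥ ⊢ A, ¬A. -/
def LEM (C : Set Form → Set Form → Prop) : Prop :=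
  ∀ A : Form, C {Form.neg Form.fls} {A, Form.neg A}

/-- The alternative defining conditions of ⊢_CL (Theorem 1 of the paper):
the BDL conditions together with LNC and LEM. -/
def AltConds (C : Set Form → Set Form → Prop) : Prop :=
  BDLconds C ∧ LNC C ∧ LEM C

/-- `C` is the smallest structural and non-trivial logical consequence
relation satisfying the conditions `P`. -/
def IsSmallest (P : (Set Form → Set Form → Prop) → Prop)
    (C : Set Form → Set Form → Prop) : Prop :=
  (IsConsRel C ∧ Structural C ∧ NonTrivial C ∧ P C) ∧
  ∀ C' : Set Form → Set Form → Prop,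
    IsConsRel C' ∧ Structural C' ∧ NonTrivial C' ∧ P C' →
    ∀ Γ Δ : Set Form, C Γ Δ → C' Γ Δ

/-- Truth/falsity evaluation in the three-valued semantics. -/
def Form.ev (v : ℕ → Prop × Prop) : Form → Prop × Prop
  | .var p => v p
  | .fls => (False, True)
  | .neg A => ((A.ev v).2, (A.ev v).1)
  | .conj A B => ((A.ev v).1 ∧ (B.ev v).1, (A.ev v).2 ∨ (B.ev v).2)
  | .disj A B => ((A.ev v).1 ∨ (B.ev v).1, (A.ev v).2 ∧ (B.ev v).2)
  | .impl A B => ((A.ev v).1 → (B.ev v).1, (A.ev v).1 ∧ (B.ev v).2)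

theorem Form.ev_lem (v : ℕ → Prop × Prop) (hv : ∀ n, (v n).1 ∨ (v n).2) (A : Form) :
    (A.ev v).1 ∨ (A.ev v).2 := by
  induction A <;> simp only [Form.ev] <;> first | apply hv | tauto

theorem Form.ev_subst (v : ℕ → Prop × Prop) (σ : ℕ → Form) (A : Form) :
    (A.subst σ).ev v = A.ev (fun n => (σ n).ev v) := by
  induction A <;> simp_all [Form.ev, Form.subst]

/-- Semantic consequence. -/
def SemC (Γ Δ : Set Form) : Prop :=
  ∀ v : ℕ → Prop × Prop, (∀ n, (v n).1 ∨ (v n).2) →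
    (∀ A ∈ Γ, (A.ev v).1) → ∃ B ∈ Δ, (B.ev v).1

theorem semC_not (p q : ℕ) (h : p ≠ q) :
    ¬ SemC {Form.neg (Form.var p), Form.var p} {Form.var q} := by
  intro hC
  have := hC (fun n => (n ≠ q, True)) (by simp) (by simp [Form.ev, h])
  simp [Form.ev] at this

theorem semC_cons : IsConsRel SemC := by
  refine ⟨?_, ?_, ?_⟩
  · rintro Γ Δ ⟨A, h1, h2⟩ v hv h
    exact ⟨A, h2, h A h1⟩
  · intro Γ Δ Γ' Δ' h h1 h2 v hv hG
    obtain ⟨B, hB, hb⟩ := h v hv (fun A hA => hG A (h1 hA))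
    exact ⟨B, h2 hB, hb⟩
  · intro Γ Δ Γ' Δ' A h1 h2 v hv hG
    obtain ⟨B, hB, hb⟩ := h1 v hv (fun A hA => hG A (Or.inl hA))
    rcases hB with rfl | hB
    · obtain ⟨D, hD, hd⟩ := h2 v hv (by
        rintro E (rfl | hE)
        · exact hb
        · exact hG E (Or.inr hE))
      exact ⟨D, Or.inr hD, hd⟩
    · exact ⟨B, Or.inl hB, hb⟩

theorem semC_struct : Structural SemC := by
  intro Γ Δ σ h v hv hG
  obtain ⟨B, hB, hb⟩ := h (fun n => (σ n).ev v) (fun n => Form.ev_lem v hv _) (by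
    intro A hA
    rw [← Form.ev_subst]
    exact hG _ ⟨A, hA, rfl⟩)
  exact ⟨_, ⟨B, hB, rfl⟩, by rw [Form.ev_subst]; exact hb⟩

theorem semC_bdl : BDLconds SemC := by
  refine ⟨?_, ?_, ?_, ?_, ?_, ?_, ?_, ?_, ?_⟩ <;> intros <;>
    simp only [SemC, Set.forall_mem_insert, Set.exists_mem_insert, Form.ev, ← forall_and] <;>
    first
    | (refine forall_congr' fun v => ?_; tauto)
    | (intro v; tauto)

theorem semC_lem : LEM SemC := by
  intro A v hv _
  rcases Form.ev_lem v hv A with h | h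
  · exact ⟨A, by simp, h⟩
  · exact ⟨.neg A, by simp, h⟩

/-- The logic obtained by dropping only LNC is paraconsistent:
where ⊢_LPL is the smallest structural non-trivial consequence relation
satisfying the BDL conditions together with LEM, for distinct propositional
variables p and q, not {¬p, p} ⊢_LPL {q}. -/
theorem stmt_14 (LPL : Set Form → Set Form → Prop)
    (h : IsSmallest (fun R => BDLconds R ∧ LEM R) LPL) :
    ∀ p q : ℕ, p ≠ q →
      ¬ LPL {Form.neg (Form.var p), Form.var p} {Form.var q} := by 
  intro p q hpq hL
  exact semC_not p q hpq (h.2 SemC ⟨semC_cons, semC_struct,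
    ⟨_, _, Set.insert_nonempty _ _, Set.singleton_nonempty _, semC_not p q hpq⟩, semC_bdl, semC_lem⟩ _ _ hL)
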